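/- arXiv:2604.27833 — 3 statements merged into one kernel-verified Lean document; each statement's English description precedes it below -/
import Mathlib

section
/- Let d_A, d_B ≥ 1 with d = d_A + d_B. Let Δ_A, Δ_B > 0, σ_A, σ_B, σ_ref > 0 with 1/σ_A² + 1/σ_B² ≤ 1/σ_ref². Let μ, μ' ∈ ℝ^d be two mean vectors whose difference v = μ − μ' satisfies ‖v_A‖₂ ≤ Δ_A on the first d_A coordinates and ‖v_B‖₂ ≤ Δ_B on the remaining d_B coordinates. Let P and Q be the product Gaussian measures on ℝ^d with means μ and μ' respectively, whose first d_A coordinates have variance (σ_A Δ_A)² and whose remaining d_B coordinates have variance (σ_B Δ_B)². Then for every α > 1, D_α(P‖Q) ≤ α/(2σ_ref²). -/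
open MeasureTheory ProbabilityTheory

/-- Rényi divergence of order `α`: `D_α(P‖Q) = (1/(α−1))·log ∫ (dP/dQ)^α dQ`. -/
noncomputable def renyiDiv {Ω : Type*} [MeasurableSpace Ω] (α : ℝ) (P Q : Measure Ω) : ℝ :=
  (α - 1)⁻¹ * Real.log (∫ x, (P.rnDeriv Q x).toReal ^ α ∂Q)

/-- One-dimensional Gaussian likelihood ratio. -/
noncomputable def gaussLR (m m' : ℝ) (v : NNReal) (x : ℝ) : ℝ :=
  Real.exp ((m - m') / v * x - (m ^ 2 - m' ^ 2) / (2 * v))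

lemma gaussLR_integrable (m m' : ℝ) (v : NNReal) :
    Integrable (gaussLR m m' v) (gaussianReal m' v) := by
  have h := (integrable_exp_mul_gaussianReal (μ := m') (v := v) ((m - m') / v)).mul_const
    (Real.exp (-((m ^ 2 - m' ^ 2) / (2 * v))))
  refine h.congr (Filter.Eventually.of_forall fun x => ?_)
  simp only [gaussLR, sub_eq_add_neg, Real.exp_add]

lemma gaussLR_measurable (m m' : ℝ) (v : NNReal) : Measurable (gaussLR m m' v) := by
  unfold gaussLR; fun_prop

lemma gaussian_eq_withDensity (m m' : ℝ) (v : NNReal) (hv : v ≠ 0) :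
    gaussianReal m v
      = (gaussianReal m' v).withDensity (fun x => ENNReal.ofReal (gaussLR m m' v x)) := by
  rw [gaussianReal_of_var_ne_zero _ hv, gaussianReal_of_var_ne_zero _ hv,
    ← withDensity_mul _ (measurable_gaussianPDF _ _) (gaussLR_measurable m m' v).ennreal_ofReal]
  congr 1
  ext x
  have hv' : (v : ℝ) ≠ 0 := by exact_mod_cast hv
  simp only [Pi.mul_apply, gaussianPDF]
  rw [← ENNReal.ofReal_mul (gaussianPDFReal_nonneg _ _ _)]
  congr 1
  simp only [gaussianPDFReal, gaussLR]
  rw [mul_assoc _ (Real.exp _) (Real.exp _), ← Real.exp_add]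
  congr 2
  field_simp
  ring

lemma pi_eq_withDensity {n : ℕ} (m m' : Fin n → ℝ) (v : Fin n → NNReal) (hv : ∀ i, v i ≠ 0) :
    Measure.pi (fun i => gaussianReal (m i) (v i))
      = (Measure.pi (fun i => gaussianReal (m' i) (v i))).withDensity
        (fun x => ENNReal.ofReal (∏ i, gaussLR (m i) (m' i) (v i) (x i))) := by
  refine Measure.pi_eq fun s hs => ?_
  have hpos : ∀ i x, 0 ≤ gaussLR (m i) (m' i) (v i) x := fun i x => (Real.exp_pos _).le
  rw [withDensity_apply _ (MeasurableSet.univ_pi hs), Measure.restrict_pi_pi,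
    ← ofReal_integral_eq_lintegral_ofReal]
  · rw [integral_fintype_prod_eq_prod (f := fun i => gaussLR (m i) (m' i) (v i)),
      ENNReal.ofReal_prod_of_nonneg (fun i _ => integral_nonneg (hpos i))]
    refine Finset.prod_congr rfl fun i _ => ?_
    rw [gaussian_eq_withDensity (m i) (m' i) (v i) (hv i), withDensity_apply _ (hs i),
      ofReal_integral_eq_lintegral_ofReal (gaussLR_integrable _ _ _).restrict
        (Filter.Eventually.of_forall (hpos i))]
  · exact Integrable.fintype_prod (f := fun i => gaussLR (m i) (m' i) (v i))
      fun i => (gaussLR_integrable _ _ _).restrict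
  · exact Filter.Eventually.of_forall fun x => Finset.prod_nonneg fun i _ => hpos i _

lemma integral_gaussLR_rpow (m m' : ℝ) (v : NNReal) (hv : v ≠ 0) (α : ℝ) :
    ∫ x, gaussLR m m' v x ^ α ∂gaussianReal m' v
      = Real.exp (α * (α - 1) * ((m - m') ^ 2 / (2 * v))) := by
  have hv' : (v : ℝ) ≠ 0 := by exact_mod_cast hv
  have h := congrFun (mgf_fun_id_gaussianReal (μ := m') (v := v)) (α * ((m - m') / v))
  simp only [mgf] at h
  have : ∀ x, gaussLR m m' v x ^ α
      = Real.exp (α * ((m - m') / v) * x) * Real.exp (-(α * ((m ^ 2 - m' ^ 2) / (2 * v)))) := by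
    intro x
    rw [gaussLR, ← Real.exp_mul, ← Real.exp_add]
    congr 1
    ring
  simp_rw [this]
  rw [integral_mul_const, h, ← Real.exp_add]
  congr 1
  field_simp
  ring

lemma renyiDiv_pi_gaussian {n : ℕ} (m m' : Fin n → ℝ) (v : Fin n → NNReal)
    (hv : ∀ i, v i ≠ 0) (α : ℝ) (hα : 1 < α) :
    renyiDiv α (Measure.pi fun i => gaussianReal (m i) (v i))
      (Measure.pi fun i => gaussianReal (m' i) (v i))
      = α * ∑ i, (m i - m' i) ^ 2 / (2 * v i) := by
  have hpos : ∀ i x, 0 ≤ gaussLR (m i) (m' i) (v i) x := fun i x => (Real.exp_pos _).le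
  have hmeas : Measurable fun x : Fin n → ℝ =>
      ENNReal.ofReal (∏ i, gaussLR (m i) (m' i) (v i) (x i)) := by
    refine Measurable.ennreal_ofReal (Finset.measurable_prod _ fun i _ => ?_)
    exact (gaussLR_measurable _ _ _).comp (measurable_pi_apply i)
  have hrn := Measure.rnDeriv_withDensity (Measure.pi fun i => gaussianReal (m' i) (v i)) hmeas
  rw [← pi_eq_withDensity m m' v hv] at hrn
  have hint : ∫ x, ((Measure.pi fun i => gaussianReal (m i) (v i)).rnDeriv
      (Measure.pi fun i => gaussianReal (m' i) (v i)) x).toReal ^ α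
        ∂(Measure.pi fun i => gaussianReal (m' i) (v i))
      = Real.exp (∑ i, α * (α - 1) * ((m i - m' i) ^ 2 / (2 * v i))) := by
    rw [Real.exp_sum]
    simp_rw [← integral_gaussLR_rpow (m _) (m' _) (v _) (hv _) α]
    rw [← integral_fintype_prod_eq_prod (f := fun i x => gaussLR (m i) (m' i) (v i) x ^ α)]
    refine integral_congr_ae ?_
    filter_upwards [hrn] with x hx
    rw [hx, ENNReal.toReal_ofReal (Finset.prod_nonneg fun i _ => hpos i _),
      Real.finsetProd_rpow _ _ (fun i _ => hpos i _)]
  rw [renyiDiv, hint, Real.log_exp, ← Finset.mul_sum]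
  have : α - 1 ≠ 0 := by linarith
  field_simp

/-- Groupwise Gaussian release: for product Gaussians on `ℝ^{d_A + d_B}` whose means differ
by `v` with `‖v_A‖₂ ≤ Δ_A` on the first `d_A` coordinates and `‖v_B‖₂ ≤ Δ_B` on the rest,
variances `(σ_A Δ_A)²` on the first block and `(σ_B Δ_B)²` on the second, the calibration
condition `1/σ_A² + 1/σ_B² ≤ 1/σ_ref²` gives `D_α(P‖Q) ≤ α/(2σ_ref²)` for every `α > 1`. -/
theorem renyiDiv_groupwise_gaussian_le (dA dB : ℕ) (hdA : 1 ≤ dA) (hdB : 1 ≤ dB)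
    (ΔA ΔB σA σB σref : ℝ) (hΔA : 0 < ΔA) (hΔB : 0 < ΔB)
    (hσA : 0 < σA) (hσB : 0 < σB) (hσref : 0 < σref)
    (hcal : 1 / σA ^ 2 + 1 / σB ^ 2 ≤ 1 / σref ^ 2)
    (μ μ' : Fin (dA + dB) → ℝ)
    (hA : Real.sqrt (∑ i : Fin dA,
        (μ (Fin.castAdd dB i) - μ' (Fin.castAdd dB i)) ^ 2) ≤ ΔA)
    (hB : Real.sqrt (∑ i : Fin dB,
        (μ (Fin.natAdd dA i) - μ' (Fin.natAdd dA i)) ^ 2) ≤ ΔB)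
    (α : ℝ) (hα : 1 < α) :
    renyiDiv α
      (Measure.pi fun j => gaussianReal (μ j)
        (Real.toNNReal (if (j : ℕ) < dA then (σA * ΔA) ^ 2 else (σB * ΔB) ^ 2)))
      (Measure.pi fun j => gaussianReal (μ' j)
        (Real.toNNReal (if (j : ℕ) < dA then (σA * ΔA) ^ 2 else (σB * ΔB) ^ 2)))
      ≤ α / (2 * σref ^ 2) := by
  rw [renyiDiv_pi_gaussian]
  · rw [Fin.sum_univ_add]
    have hSA := (Real.sqrt_le_left hΔA.le).1 hA
    have hSB := (Real.sqrt_le_left hΔB.le).1 hB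
    simp only [Fin.val_castAdd, Fin.is_lt, if_true, Fin.val_natAdd,
      Nat.not_lt.2 (Nat.le_add_right _ _), if_false, ← Finset.sum_div]
    rw [Real.coe_toNNReal _ (sq_nonneg _), Real.coe_toNNReal _ (sq_nonneg _)]
    have h1 : (∑ i : Fin dA, (μ (Fin.castAdd dB i) - μ' (Fin.castAdd dB i)) ^ 2)
        / (2 * (σA * ΔA) ^ 2) ≤ (1 / σA ^ 2) / 2 := by
      calc _ ≤ ΔA ^ 2 / (2 * (σA * ΔA) ^ 2) := by gcongr
        _ = _ := by field_simp
    have h2 : (∑ i : Fin dB, (μ (Fin.natAdd dA i) - μ' (Fin.natAdd dA i)) ^ 2)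
        / (2 * (σB * ΔB) ^ 2) ≤ (1 / σB ^ 2) / 2 := by
      calc _ ≤ ΔB ^ 2 / (2 * (σB * ΔB) ^ 2) := by gcongr
        _ = _ := by field_simp
    calc _ ≤ α * ((1 / σref ^ 2) / 2) := by
          refine mul_le_mul_of_nonneg_left ?_ (by linarith)
          linarith
      _ = _ := by field_simp
  · intro i
    have h : 0 < (if (i : ℕ) < dA then (σA * ΔA) ^ 2 else (σB * ΔB) ^ 2) := by
      split_ifs <;> positivity
    exact (Real.toNNReal_pos.2 h).ne'
  · exact hα
end

section
/- Under the hypotheses of the groupwise Gaussian release (d_A, d_B ≥ 1, d = d_A + d_B; Δ_A, Δ_B > 0; σ_A, σ_B, σ_ref > 0 with 1/σ_A² + 1/σ_B² ≤ 1/σ_ref²; means μ, μ' ∈ ℝ^d whose difference satisfies ‖v_A‖₂ ≤ Δ_A on the first d_A coordinates and ‖v_B‖₂ ≤ Δ_B on the remaining; P, Q the corresponding product Gaussians with variances (σ_A Δ_A)² on the first block and (σ_B Δ_B)² on the second), the following holds: for every α > 1, every δ ∈ (0,1), and every measurable set S ⊆ ℝ^d, P(S) ≤ exp(α/(2σ_ref²)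 + log(1/δ)/(α−1))·Q(S) + δ. -/
open MeasureTheory ProbabilityTheory

lemma aux_lintegral_prod {n : ℕ} (ν : Fin n → Measure ℝ) [∀ i, SigmaFinite (ν i)]
    (f : Fin n → ℝ → ℝ) (hf : ∀ i, Integrable (f i) (ν i)) (h0 : ∀ i x, 0 ≤ f i x) :
    ∫⁻ x, ENNReal.ofReal (∏ i, f i (x i)) ∂(Measure.pi ν)
      = ∏ i, ∫⁻ x, ENNReal.ofReal (f i x) ∂(ν i) := by
  rw [← ofReal_integral_eq_lintegral_ofReal (Integrable.fintype_prod hf)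
    (Filter.Eventually.of_forall fun x => Finset.prod_nonneg fun i _ => h0 i _),
    integral_fintype_prod_eq_prod,
    ENNReal.ofReal_prod_of_nonneg (fun i _ => integral_nonneg (h0 i))]
  exact Finset.prod_congr rfl fun i _ => ofReal_integral_eq_lintegral_ofReal (hf i)
    (Filter.Eventually.of_forall (h0 i))

lemma aux_int (m : ℝ) (v : NNReal) (c b : ℝ) :
    Integrable (fun x => Real.exp (c * x + b)) (gaussianReal m v) := by
  simp_rw [Real.exp_add]
  exact (integrable_exp_mul_gaussianReal c).mul_const _

lemma aux_lint (m : ℝ) (v : NNReal) (c b : ℝ) :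
    ∫⁻ x, ENNReal.ofReal (Real.exp (c * x + b)) ∂(gaussianReal m v)
      = ENNReal.ofReal (Real.exp (m * c + v * c ^ 2 / 2 + b)) := by
  rw [← ofReal_integral_eq_lintegral_ofReal (aux_int m v c b)
    (Filter.Eventually.of_forall fun x => (Real.exp_pos _).le)]
  congr 1
  have := congrFun (mgf_fun_id_gaussianReal (μ := m) (v := v)) c
  simp only [mgf] at this
  simp_rw [Real.exp_add _ b]
  rw [integral_mul_const, this]

lemma aux_wd (m m' : ℝ) (v : NNReal) (hv : v ≠ 0) :
    gaussianReal m v = (gaussianReal m' v).withDensity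
      (fun x => ENNReal.ofReal (Real.exp ((m - m') / v * x + (m' ^ 2 - m ^ 2) / (2 * v)))) := by
  rw [gaussianReal_of_var_ne_zero m hv, gaussianReal_of_var_ne_zero m' hv,
    ← withDensity_mul _ (measurable_gaussianPDF _ _) (by fun_prop)]
  congr 1
  ext x
  have hv' : (v : ℝ) ≠ 0 := by exact_mod_cast hv
  simp only [Pi.mul_apply, gaussianPDF]
  rw [← ENNReal.ofReal_mul (gaussianPDFReal_nonneg _ _ _), gaussianPDFReal, gaussianPDFReal,
    mul_assoc _ (Real.exp _) (Real.exp _), ← Real.exp_add]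
  congr 3
  field_simp
  ring

lemma aux_pi {n : ℕ} (m m' : Fin n → ℝ) (v : Fin n → NNReal) (hv : ∀ i, v i ≠ 0) :
    (Measure.pi fun i => gaussianReal (m i) (v i))
      = (Measure.pi fun i => gaussianReal (m' i) (v i)).withDensity
      (fun x => ENNReal.ofReal (∏ i, Real.exp ((m i - m' i) / v i * x i
        + (m' i ^ 2 - m i ^ 2) / (2 * v i)))) := by
  refine Measure.pi_eq fun s hs => ?_
  rw [withDensity_apply _ (MeasurableSet.univ_pi hs), Measure.restrict_pi_pi,
    aux_lintegral_prod _ (fun i y => Real.exp ((m i - m' i) / v i * y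
        + (m' i ^ 2 - m i ^ 2) / (2 * v i))) (fun i => (aux_int _ _ _ _).restrict)
        (fun i x => (Real.exp_pos _).le)]
  refine Finset.prod_congr rfl fun i _ => ?_
  rw [aux_wd (m i) (m' i) (v i) (hv i), withDensity_apply _ (hs i)]

lemma aux_main {n : ℕ} (m m' : Fin n → ℝ) (v : Fin n → NNReal) (hv : ∀ i, v i ≠ 0)
    (D : ℝ) (hD : ∑ i, (m i - m' i) ^ 2 / (v i : ℝ) ≤ D)
    (α : ℝ) (hα : 1 < α) (δ : ℝ) (hδ : 0 < δ)
    (S : Set (Fin n → ℝ)) (hS : MeasurableSet S) :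
    (Measure.pi fun i => gaussianReal (m i) (v i)) S
      ≤ ENNReal.ofReal (Real.exp (α / 2 * D + Real.log (1 / δ) / (α - 1)))
        * (Measure.pi fun i => gaussianReal (m' i) (v i)) S + ENNReal.ofReal δ := by
  set ε := α / 2 * D + Real.log (1 / δ) / (α - 1) with hε
  set P := Measure.pi fun i => gaussianReal (m i) (v i) with hP
  set Q := Measure.pi fun i => gaussianReal (m' i) (v i) with hQ
  let L : (Fin n → ℝ) → ℝ := fun x => ∑ i, ((m i - m' i) / v i * x i
        + (m' i ^ 2 - m i ^ 2) / (2 * v i))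
  have hLm : Measurable L := by fun_prop
  have hPQ : P = Q.withDensity (fun x => ENNReal.ofReal (Real.exp (L x))) := by
    rw [hP, aux_pi m m' v hv]
    simp only [L, Real.exp_sum, hQ]
  have hG : MeasurableSet {x | L x ≤ ε} := measurableSet_le hLm measurable_const
  have h1 : P (S ∩ {x | L x ≤ ε}) ≤ ENNReal.ofReal (Real.exp ε) * Q S := by
    rw [hPQ, withDensity_apply _ (hS.inter hG)]
    calc _ ≤ ∫⁻ x in S ∩ {x | L x ≤ ε}, ENNReal.ofReal (Real.exp ε) ∂Q := by
          refine setLIntegral_mono measurable_const fun x hx => ?_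
          exact ENNReal.ofReal_le_ofReal (Real.exp_le_exp.2 hx.2)
      _ = ENNReal.ofReal (Real.exp ε) * Q (S ∩ {x | L x ≤ ε}) := by simp
      _ ≤ _ := by gcongr; exact Set.inter_subset_left
  have hint : ∫⁻ x, ENNReal.ofReal (Real.exp ((α - 1) * L x - (α - 1) * ε)) ∂P
      ≤ ENNReal.ofReal δ := by
    have e1 : ∀ x, ENNReal.ofReal (Real.exp ((α - 1) * L x - (α - 1) * ε))
        = ENNReal.ofReal (Real.exp (- ((α - 1) * ε))) * ENNReal.ofReal (∏ i, Real.exp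
          (((α - 1) * ((m i - m' i) / v i)) * x i
            + (α - 1) * ((m' i ^ 2 - m i ^ 2) / (2 * v i)))) := by
      intro x
      rw [← ENNReal.ofReal_mul (Real.exp_pos _).le, ← Real.exp_sum, ← Real.exp_add]
      congr 2
      simp only [L, Finset.mul_sum, mul_add, mul_assoc]
      ring
    simp_rw [e1]
    rw [lintegral_const_mul _ (by fun_prop), hP, aux_lintegral_prod _ (fun i y => Real.exp
          (((α - 1) * ((m i - m' i) / v i)) * y
            + (α - 1) * ((m' i ^ 2 - m i ^ 2) / (2 * v i)))) (fun i => aux_int _ _ _ _)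
        (fun i x => (Real.exp_pos _).le)]
    simp_rw [aux_lint]
    rw [← ENNReal.ofReal_prod_of_nonneg (fun i _ => (Real.exp_pos _).le),
      ← ENNReal.ofReal_mul (Real.exp_pos _).le, ← Real.exp_sum, ← Real.exp_add]
    apply ENNReal.ofReal_le_ofReal
    rw [← Real.le_log_iff_exp_le hδ]
    have e2 : ∀ i, m i * ((α - 1) * ((m i - m' i) / v i))
        + v i * ((α - 1) * ((m i - m' i) / v i)) ^ 2 / 2
        + (α - 1) * ((m' i ^ 2 - m i ^ 2) / (2 * v i))
        = (α - 1) * (α / 2) * ((m i - m' i) ^ 2 / (v i : ℝ)) := by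
      intro i
      have hv' : (v i : ℝ) ≠ 0 := by exact_mod_cast hv i
      field_simp
      ring
    simp_rw [e2]
    rw [← Finset.mul_sum]
    have e3 : (α - 1) * ε = (α - 1) * (α / 2) * D - Real.log δ := by
      have : α - 1 ≠ 0 := by linarith
      rw [hε, one_div, Real.log_inv]
      field_simp
      ring
    have := mul_le_mul_of_nonneg_left hD
      (show 0 ≤ (α - 1) * (α / 2) from mul_nonneg (by linarith) (by linarith))
    linarith
  have h2 : P (S \ {x | L x ≤ ε}) ≤ ENNReal.ofReal δ := by
    refine (meas_le_lintegral₀ (by fun_prop) fun x hx => ?_).trans hint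
    have hx2 : ε < L x := not_le.1 hx.2
    rw [ENNReal.one_le_ofReal]
    apply Real.one_le_exp
    nlinarith
  calc P S ≤ P (S ∩ {x | L x ≤ ε}) + P (S \ {x | L x ≤ ε}) := measure_le_inter_add_sdiff _ _ _
    _ ≤ _ := add_le_add h1 h2

/-- Single-round `(ε, δ)`-indistinguishability of the variance-adaptive groupwise
Gaussian release: under the groupwise sensitivity bounds and the calibration condition
`1/σ_A² + 1/σ_B² ≤ 1/σ_ref²`, for every `α > 1`, `δ ∈ (0,1)`, and measurable `S ⊆ ℝ^d`,
`P(S) ≤ exp(α/(2σ_ref²) + log(1/δ)/(α−1))·Q(S) + δ`. -/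
theorem groupwise_gaussian_eps_delta (dA dB : ℕ) (hdA : 1 ≤ dA) (hdB : 1 ≤ dB)
    (ΔA ΔB σA σB σref : ℝ) (hΔA : 0 < ΔA) (hΔB : 0 < ΔB)
    (hσA : 0 < σA) (hσB : 0 < σB) (hσref : 0 < σref)
    (hcal : 1 / σA ^ 2 + 1 / σB ^ 2 ≤ 1 / σref ^ 2)
    (μ μ' : Fin (dA + dB) → ℝ)
    (hA : Real.sqrt (∑ i : Fin dA,
        (μ (Fin.castAdd dB i) - μ' (Fin.castAdd dB i)) ^ 2) ≤ ΔA)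
    (hB : Real.sqrt (∑ i : Fin dB,
        (μ (Fin.natAdd dA i) - μ' (Fin.natAdd dA i)) ^ 2) ≤ ΔB)
    (α : ℝ) (hα : 1 < α) (δ : ℝ) (hδ : δ ∈ Set.Ioo (0 : ℝ) 1)
    (S : Set (Fin (dA + dB) → ℝ)) (hS : MeasurableSet S) :
    (Measure.pi fun j => gaussianReal (μ j)
        (Real.toNNReal (if (j : ℕ) < dA then (σA * ΔA) ^ 2 else (σB * ΔB) ^ 2))) S
      ≤ ENNReal.ofReal
          (Real.exp (α / (2 * σref ^ 2) + Real.log (1 / δ) / (α - 1)))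
        * (Measure.pi fun j => gaussianReal (μ' j)
            (Real.toNNReal (if (j : ℕ) < dA then (σA * ΔA) ^ 2 else (σB * ΔB) ^ 2))) S
        + ENNReal.ofReal δ := by
  have hvA : 0 < (σA * ΔA) ^ 2 := by positivity
  have hvB : 0 < (σB * ΔB) ^ 2 := by positivity
  have hpos : ∀ j : Fin (dA + dB),
      0 < (if (j : ℕ) < dA then (σA * ΔA) ^ 2 else (σB * ΔB) ^ 2) := by
    intro j; split_ifs <;> assumption
  have key := aux_main μ μ'
    (fun j => Real.toNNReal (if (j : ℕ) < dA then (σA * ΔA) ^ 2 else (σB * ΔB) ^ 2))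
    (fun j => (Real.toNNReal_pos.2 (hpos j)).ne') (1 / σref ^ 2) ?_ α hα δ hδ.1 S hS
  · have e : α / 2 * (1 / σref ^ 2) = α / (2 * σref ^ 2) := by field_simp
    rw [e] at key
    exact key
  · simp_rw [Real.coe_toNNReal _ (hpos _).le]
    rw [Fin.sum_univ_add]
    simp only [Fin.val_castAdd, Fin.is_lt, if_true, Fin.val_natAdd, not_lt.2 (Nat.le_add_right _ _),
      if_false]
    rw [← Finset.sum_div, ← Finset.sum_div]
    have hA' := (Real.sqrt_le_left hΔA.le).1 hA
    have hB' := (Real.sqrt_le_left hΔB.le).1 hB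
    refine le_trans (add_le_add ?_ ?_) hcal
    · calc _ ≤ ΔA ^ 2 / (σA * ΔA) ^ 2 := by gcongr
        _ = _ := by field_simp
    · calc _ ≤ ΔB ^ 2 / (σB * ΔB) ^ 2 := by gcongr
        _ = _ := by field_simp
end

section
/- Let Δ > 0, ε ∈ (0, 1], δ ∈ (0, 1), and let σ ≥ Δ·√(2·log(1.25/δ))/ε. Then for any μ, μ' ∈ ℝ with |μ − μ'| ≤ Δ, the Gaussian measures P = N(μ, σ²) and Q = N(μ', σ²) satisfy, for every measurable set S ⊆ ℝ, P(S) ≤ e^ε·Q(S) + δ. -/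
open MeasureTheory ProbabilityTheory

/-- Elementary inequality behind the proof. -/
lemma aux_one_sub_exp (l x : ℝ) (hl : 0 ≤ l) :
    1 - Real.exp (-x) ≤ Real.exp (l * x) / (1 + l) := by
  have h1 : 0 < 1 + l := by linarith
  rw [le_div_iff₀ h1]
  have h2 := Real.add_one_le_exp (l * x)
  have h3 := Real.add_one_le_exp (-x)
  have h4 := Real.exp_pos (-x)
  nlinarith [mul_nonneg hl (by linarith : (0 : ℝ) ≤ Real.exp (-x) - (-x + 1))]

lemma aux_pdf (μ μ' ε l : ℝ) (v : NNReal) (hv : v ≠ 0) (hl : 0 ≤ l) (x : ℝ) :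
    gaussianPDFReal μ v x ≤ Real.exp ε * gaussianPDFReal μ' v x
      + Real.exp (l * (l + 1) * (μ - μ') ^ 2 / (2 * v) - l * ε) / (1 + l)
        * gaussianPDFReal (μ + l * (μ - μ')) v x := by
  have hv' : (v : ℝ) ≠ 0 := by exact_mod_cast hv
  set t : ℝ := ((x - μ') ^ 2 - (x - μ) ^ 2) / (2 * v) - ε with ht
  have key := aux_one_sub_exp l t hl
  have hp := gaussianPDFReal_nonneg μ v x
  have e1 : Real.exp ε * gaussianPDFReal μ' v x = gaussianPDFReal μ v x * Real.exp (-t) := by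
    simp only [gaussianPDFReal]
    rw [mul_left_comm, ← Real.exp_add, mul_assoc _ (Real.exp _) (Real.exp _), ← Real.exp_add]
    congr 2
    rw [ht]; field_simp; ring
  have e2 : Real.exp (l * (l + 1) * (μ - μ') ^ 2 / (2 * v) - l * ε)
        * gaussianPDFReal (μ + l * (μ - μ')) v x
      = gaussianPDFReal μ v x * Real.exp (l * t) := by
    simp only [gaussianPDFReal]
    rw [mul_left_comm, ← Real.exp_add, mul_assoc _ (Real.exp _) (Real.exp _), ← Real.exp_add]
    congr 2
    rw [ht]; field_simp; ring
  rw [div_mul_eq_mul_div, e1, e2]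
  have := mul_le_mul_of_nonneg_left key hp
  rw [← mul_div_assoc] at this
  linarith

/-- Single-round `(ε, δ)`-indistinguishability of the Gaussian mechanism: if
`σ ≥ Δ·√(2·log(1.25/δ))/ε` with `ε ∈ (0,1]`, `δ ∈ (0,1)`, then for means with
`|μ − μ'| ≤ Δ`, `N(μ,σ²)(S) ≤ e^ε·N(μ',σ²)(S) + δ` for every measurable `S`. -/
theorem gaussian_mechanism_eps_delta (Δ ε δ σ : ℝ) (hΔ : 0 < Δ)
    (hε : ε ∈ Set.Ioc (0 : ℝ) 1) (hδ : δ ∈ Set.Ioo (0 : ℝ) 1)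
    (hσ : Δ * Real.sqrt (2 * Real.log (1.25 / δ)) / ε ≤ σ)
    (μ μ' : ℝ) (hμ : |μ - μ'| ≤ Δ) (S : Set ℝ) (hS : MeasurableSet S) :
    gaussianReal μ (σ ^ 2).toNNReal S
      ≤ ENNReal.ofReal (Real.exp ε) * gaussianReal μ' (σ ^ 2).toNNReal S
        + ENNReal.ofReal δ := by
  obtain ⟨hε0, hε1⟩ := hε
  obtain ⟨hδ0, hδ1⟩ := hδ
  set L := Real.log (1.25 / δ) with hL
  have hq : 0 < 1.25 / δ := by positivity
  have hL2 : (1 : ℝ) / 5 ≤ L := by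
    have := Real.one_sub_inv_le_log_of_pos hq
    rw [inv_div] at this
    have h2 : δ / 1.25 ≤ 4 / 5 := by rw [div_le_iff₀ (by norm_num)]; norm_num; linarith
    linarith
  have hexpL : Real.exp (-L) = δ / 1.25 := by
    rw [Real.exp_neg, hL, Real.exp_log hq, inv_div]
  set c := Real.sqrt (2 * L) with hc
  have hc0 : 0 < c := Real.sqrt_pos.2 (by linarith)
  have hc2 : c ^ 2 = 2 * L := Real.sq_sqrt (by linarith)
  have hσ0 : 0 < σ := lt_of_lt_of_le (by positivity) hσ
  have hv : (σ ^ 2).toNNReal ≠ 0 := by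
    rw [Ne, Real.toNNReal_eq_zero]; push Not; positivity
  have hvc : (((σ ^ 2).toNNReal : NNReal) : ℝ) = σ ^ 2 := Real.coe_toNNReal _ (by positivity)
  set l := 2 * L / ε with hl
  have hl1 : 2 / 5 ≤ l := by
    rw [hl, le_div_iff₀ hε0]; nlinarith
  have hlε : l * ε = 2 * L := by rw [hl]; field_simp
  -- the ratio bound
  have hd : (μ - μ') ^ 2 * (2 * L) ≤ ε ^ 2 * σ ^ 2 := by
    have h1 : (μ - μ') ^ 2 ≤ Δ ^ 2 := by
      rw [← sq_abs]; gcongr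
    have h2 : Δ * c ≤ σ * ε := (div_le_iff₀ hε0).1 hσ
    have h3 : (Δ * c) ^ 2 ≤ (σ * ε) ^ 2 := by gcongr
    rw [mul_pow, mul_pow, hc2] at h3
    nlinarith
  have hK : Real.exp (l * (l + 1) * (μ - μ') ^ 2 / (2 * ((σ ^ 2).toNNReal : NNReal)) - l * ε)
      / (1 + l) ≤ δ := by
    rw [hvc]
    have h1 : l * (l + 1) * (μ - μ') ^ 2 / (2 * σ ^ 2) ≤ (l + 1) * ε / 2 := by
      rw [div_le_iff₀ (by positivity)]
      have : ε * (l * (μ - μ') ^ 2) ≤ ε * (ε * σ ^ 2) := by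
        calc ε * (l * (μ - μ') ^ 2) = (μ - μ') ^ 2 * (l * ε) := by ring
          _ ≤ ε ^ 2 * σ ^ 2 := by rw [hlε]; exact hd
          _ = _ := by ring
      have h5 := le_of_mul_le_mul_left this hε0
      have := mul_le_mul_of_nonneg_left h5 (by linarith : 0 ≤ l + 1)
      linarith
    have h2 : l * (l + 1) * (μ - μ') ^ 2 / (2 * σ ^ 2) - l * ε ≤ 1 / 2 + -L := by
      nlinarith
    have h3 := Real.exp_le_exp.2 h2
    rw [Real.exp_add, hexpL] at h3
    have h4 : Real.exp (1 / 2) ≤ 7 / 4 := by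
      have h5 : Real.exp (1 / 2) ^ 2 = Real.exp 1 := by
        rw [← Real.exp_nat_mul]; norm_num
      have := Real.exp_one_lt_d9
      have := Real.exp_pos (1 / 2)
      nlinarith
    rw [div_le_iff₀ (by linarith)]
    have h6 : Real.exp (1 / 2) * (δ / 1.25) ≤ 7 / 4 * (δ / 1.25) := by gcongr
    have h7 : 7 / 4 * (δ / 1.25) = δ * (7 / 5) := by norm_num; ring
    nlinarith
  set K := Real.exp (l * (l + 1) * (μ - μ') ^ 2 / (2 * ((σ ^ 2).toNNReal : NNReal)) - l * ε)
      / (1 + l) with hKdef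
  have hK0 : 0 ≤ K := by rw [hKdef]; positivity
  set v := (σ ^ 2).toNNReal
  set m := μ + l * (μ - μ')
  have hm : gaussianReal m v S ≤ 1 := prob_le_one
  calc gaussianReal μ v S = ∫⁻ x in S, gaussianPDF μ v x := gaussianReal_apply μ hv S
    _ ≤ ∫⁻ x in S, (ENNReal.ofReal (Real.exp ε) * gaussianPDF μ' v x
          + ENNReal.ofReal K * gaussianPDF m v x) := by
        apply lintegral_mono
        intro x
        simp only [gaussianPDF]
        rw [← ENNReal.ofReal_mul (Real.exp_pos _).le, ← ENNReal.ofReal_mul hK0,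
          ← ENNReal.ofReal_add (mul_nonneg (Real.exp_pos _).le (gaussianPDFReal_nonneg _ _ _))
            (mul_nonneg hK0 (gaussianPDFReal_nonneg _ _ _))]
        exact ENNReal.ofReal_le_ofReal (aux_pdf μ μ' ε l v hv (by linarith) x)
    _ = ENNReal.ofReal (Real.exp ε) * gaussianReal μ' v S
          + ENNReal.ofReal K * gaussianReal m v S := by
        rw [lintegral_add_left ((measurable_gaussianPDF _ _).const_mul _),
          lintegral_const_mul _ (measurable_gaussianPDF _ _),
          lintegral_const_mul _ (measurable_gaussianPDF _ _),
          gaussianReal_apply μ' hv, gaussianReal_apply m hv]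
    _ ≤ ENNReal.ofReal (Real.exp ε) * gaussianReal μ' v S + ENNReal.ofReal δ := by
        gcongr
        calc ENNReal.ofReal K * gaussianReal m v S ≤ ENNReal.ofReal K * 1 := by gcongr
          _ ≤ ENNReal.ofReal δ := by rw [mul_one]; exact ENNReal.ofReal_le_ofReal hK
end
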